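/- Let r ≥ 1 and m₁ ≥ m₂ ≥ 1 be integers, let κ ≥ 3·m₂ + 1 be real, and let V ∈ ℝ^{r×r} be invertible. Define N_κ[W] = κ·W + W − W·Wᵀ·W for W ∈ ℝ^{m₁×m₂}. Let U, W₁, …, W_r ∈ ℝ^{m₁×m₂} satisfy ‖U‖_F ≤ √m₂ and ‖W_k‖_F ≤ √m₂ for 1 ≤ k ≤ r, and let D ∈ ℝ^{(r·m₁)×m₂} be the block matrix whose k-th m₁×m₂ block is N_κ[W_k] − N_κ[U]. Then the matrix C = (V^{-1} ⊗ I_{m₁})·D satisfies ‖C‖_F ≤ 2κ·‖V^{-1}‖₂·( Σ_{k=1}^{r} ‖W_k − U‖_F² )^{1/2}. -/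

import Mathlib

open Matrix
open scoped Kronecker

/-- Frobenius norm of a real matrix. -/
noncomputable def frobNorm {α β : Type*} [Fintype α] [Fintype β]
    (A : Matrix α β ℝ) : ℝ :=
  Real.sqrt (∑ i, ∑ j, (A i j) ^ 2)

/-- The `ℓ² → ℓ²` operator norm (largest singular value) of a square
real matrix. -/
noncomputable def l2OpNorm {n : ℕ} (A : Matrix (Fin n) (Fin n) ℝ) : ℝ :=
  ‖Matrix.toEuclideanCLM (𝕜 := ℝ) A‖

/-- The stabilized Allen--Cahn nonlinearity `N_κ[W] = κW + W − WWᵀW`. -/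
def Nκ {m₁ m₂ : ℕ} (κ : ℝ) (W : Matrix (Fin m₁) (Fin m₂) ℝ) :
    Matrix (Fin m₁) (Fin m₂) ℝ :=
  κ • W + W - W * Wᵀ * W

attribute [local instance] Matrix.frobeniusNormedAddCommGroup Matrix.frobeniusNormedSpace in
theorem frobNorm_eq_norm {α β : Type*} [Fintype α] [Fintype β] (A : Matrix α β ℝ) :
    frobNorm A = ‖A‖ := by
  simp [frobNorm, Matrix.frobenius_norm_def, Real.sqrt_eq_rpow]

theorem frobNorm_nonneg {α β : Type*} [Fintype α] [Fintype β] (A : Matrix α β ℝ) :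
    0 ≤ frobNorm A :=
  Real.sqrt_nonneg _

theorem frobNorm_sq {α β : Type*} [Fintype α] [Fintype β] (A : Matrix α β ℝ) :
    frobNorm A ^ 2 = ∑ i, ∑ j, (A i j) ^ 2 :=
  Real.sq_sqrt (by positivity)

attribute [local instance] Matrix.frobeniusNormedAddCommGroup Matrix.frobeniusNormedSpace in
/-- The cubic map `W ↦ WWᵀW` is Lipschitz with constant `3R²` on the Frobenius ball of radius
`R`. -/
theorem frobNorm_cubic_sub_le {α β : Type*} [Fintype α] [Fintype β] {R : ℝ}
    {W U : Matrix α β ℝ} (hW : frobNorm W ≤ R) (hU : frobNorm U ≤ R) :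
    frobNorm (W * Wᵀ * W - U * Uᵀ * U) ≤ 3 * R ^ 2 * frobNorm (W - U) := by
  have hR : 0 ≤ R := (frobNorm_nonneg W).trans hW
  simp only [frobNorm_eq_norm] at *
  have triple_le (A : Matrix α β ℝ) (B : Matrix β α ℝ) (E : Matrix α β ℝ) :
      ‖A * B * E‖ ≤ ‖A‖ * ‖B‖ * ‖E‖ :=
    (Matrix.frobenius_norm_mul _ _).trans (by gcongr; exact Matrix.frobenius_norm_mul _ _)
  have split : W * Wᵀ * W - U * Uᵀ * U =
      (W - U) * Wᵀ * W + U * (W - U)ᵀ * W + U * Uᵀ * (W - U) := by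
    simp only [Matrix.transpose_sub, Matrix.sub_mul, Matrix.mul_sub]
    abel
  calc ‖W * Wᵀ * W - U * Uᵀ * U‖
      ≤ ‖W - U‖ * ‖W‖ * ‖W‖ + ‖U‖ * ‖W - U‖ * ‖W‖ + ‖U‖ * ‖U‖ * ‖W - U‖ := by
        rw [split]
        refine norm_add₃_le.trans ?_
        gcongr <;> refine (triple_le _ _ _).trans_eq ?_ <;>
          simp only [Matrix.frobenius_norm_transpose]
    _ ≤ ‖W - U‖ * R * R + R * ‖W - U‖ * R + R * R * ‖W - U‖ := by gcongr
    _ = 3 * R ^ 2 * ‖W - U‖ := by ring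

attribute [local instance] Matrix.frobeniusNormedAddCommGroup Matrix.frobeniusNormedSpace in
theorem frobNorm_Nκ_sub_le {m₁ m₂ : ℕ} {κ R : ℝ} (hκ : 3 * R ^ 2 + 1 ≤ κ)
    {W U : Matrix (Fin m₁) (Fin m₂) ℝ} (hW : frobNorm W ≤ R) (hU : frobNorm U ≤ R) :
    frobNorm (Nκ κ W - Nκ κ U) ≤ 2 * κ * frobNorm (W - U) := by
  have cubic := frobNorm_cubic_sub_le hW hU
  have split : Nκ κ W - Nκ κ U =
      (κ + 1) • (W - U) - (W * Wᵀ * W - U * Uᵀ * U) := by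
    simp only [Nκ, add_smul, smul_sub, one_smul]
    abel
  simp only [frobNorm_eq_norm] at *
  have hκ' : 0 ≤ κ + 1 := by nlinarith [sq_nonneg R]
  calc ‖Nκ κ W - Nκ κ U‖
      ≤ (κ + 1) * ‖W - U‖ + 3 * R ^ 2 * ‖W - U‖ := by
        rw [split]
        refine (norm_sub_le _ _).trans (add_le_add ?_ cubic)
        rw [norm_smul, Real.norm_of_nonneg hκ']
    _ = (κ + 1 + 3 * R ^ 2) * ‖W - U‖ := by ring
    _ ≤ 2 * κ * ‖W - U‖ := by
        gcongr
        linarith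

theorem sum_mulVec_sq_le {n : ℕ} (A : Matrix (Fin n) (Fin n) ℝ) (x : Fin n → ℝ) :
    ∑ k, ((A *ᵥ x) k) ^ 2 ≤ l2OpNorm A ^ 2 * ∑ k, (x k) ^ 2 := by
  have h := (Matrix.toEuclideanCLM (𝕜 := ℝ) A).le_opNorm (WithLp.toLp 2 x)
  have h2 := pow_le_pow_left₀ (norm_nonneg _) h 2
  rw [mul_pow, EuclideanSpace.real_norm_sq_eq, EuclideanSpace.real_norm_sq_eq] at h2
  simpa [l2OpNorm] using h2

theorem frobNorm_kronecker_one_mul_le {r : ℕ} {α β : Type*} [Fintype α] [DecidableEq α]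
    [Fintype β] (A : Matrix (Fin r) (Fin r) ℝ) (D : Matrix (Fin r × α) β ℝ) :
    frobNorm ((A ⊗ₖ (1 : Matrix α α ℝ)) * D) ≤ l2OpNorm A * frobNorm D := by
  have apply_eq (k : Fin r) (i : α) (j : β) : ((A ⊗ₖ (1 : Matrix α α ℝ)) * D) (k, i) j =
      (A *ᵥ fun l => D (l, i) j) k := by
    simp [Matrix.mul_apply, Matrix.mulVec, dotProduct, Fintype.sum_prod_type, Matrix.one_apply]
  have sum_swap (f : Fin r × α → β → ℝ) :
      ∑ p, ∑ j, f p j = ∑ i, ∑ j, ∑ k, f (k, i) j := by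
    rw [Fintype.sum_prod_type, Finset.sum_comm]
    exact Finset.sum_congr rfl fun i _ => Finset.sum_comm
  refine (pow_le_pow_iff_left₀ (frobNorm_nonneg _)
    (mul_nonneg (norm_nonneg _) (frobNorm_nonneg _)) two_ne_zero).1 ?_
  rw [mul_pow, frobNorm_sq, frobNorm_sq, sum_swap, sum_swap]
  rw [Finset.mul_sum]
  refine Finset.sum_le_sum fun i _ => ?_
  rw [Finset.mul_sum]
  refine Finset.sum_le_sum fun j _ => ?_
  simp only [apply_eq]
  exact sum_mulVec_sq_le A _

/-- Lemma 3.2: bound on the interpolation coefficients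
`C = (V⁻¹ ⊗ I_{m₁})·D` of the rescaled ETDRK schemes. -/
theorem stmt_9 (r m₁ m₂ : ℕ) (hr : 1 ≤ r) (hm₂ : 1 ≤ m₂) (hm : m₂ ≤ m₁)
    (κ : ℝ) (hκ : 3 * (m₂ : ℝ) + 1 ≤ κ)
    (V : Matrix (Fin r) (Fin r) ℝ) (hV : IsUnit V)
    (U : Matrix (Fin m₁) (Fin m₂) ℝ)
    (W : Fin r → Matrix (Fin m₁) (Fin m₂) ℝ)
    (hU : frobNorm U ≤ Real.sqrt m₂)
    (hW : ∀ k, frobNorm (W k) ≤ Real.sqrt m₂)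
    (D : Matrix (Fin r × Fin m₁) (Fin m₂) ℝ)
    (hD : ∀ k i j, D (k, i) j = (Nκ κ (W k) - Nκ κ U) i j)
    (C : Matrix (Fin r × Fin m₁) (Fin m₂) ℝ)
    (hC : C = (V⁻¹ ⊗ₖ (1 : Matrix (Fin m₁) (Fin m₁) ℝ)) * D) :
    frobNorm C ≤
      2 * κ * l2OpNorm V⁻¹ * Real.sqrt (∑ k, frobNorm (W k - U) ^ 2) := by
  have hκ0 : 0 ≤ κ := le_trans (by positivity) hκ
  have hDW : frobNorm D ≤ 2 * κ * Real.sqrt (∑ k, frobNorm (W k - U) ^ 2) := by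
    refine (pow_le_pow_iff_left₀ (frobNorm_nonneg _) (by positivity) two_ne_zero).1 ?_
    rw [mul_pow, Real.sq_sqrt (by positivity), frobNorm_sq, Fintype.sum_prod_type,
      Finset.mul_sum]
    gcongr with k _
    simp only [hD]
    rw [← frobNorm_sq, ← mul_pow]
    gcongr
    · exact frobNorm_nonneg _
    · exact frobNorm_Nκ_sub_le (by rwa [Real.sq_sqrt (Nat.cast_nonneg _)]) (hW k) hU
  rw [hC]
  calc frobNorm ((V⁻¹ ⊗ₖ (1 : Matrix (Fin m₁) (Fin m₁) ℝ)) * D)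
      ≤ l2OpNorm V⁻¹ * frobNorm D := frobNorm_kronecker_one_mul_le _ _
    _ ≤ l2OpNorm V⁻¹ * (2 * κ * Real.sqrt (∑ k, frobNorm (W k - U) ^ 2)) :=
        mul_le_mul_of_nonneg_left hDW (norm_nonneg _)
    _ = 2 * κ * l2OpNorm V⁻¹ * Real.sqrt (∑ k, frobNorm (W k - U) ^ 2) := by ring
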